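/- Relative Deduction: For every finite set Σ of L⁺-sentences and every n ≥ 0: if Γ : Σ ⊢_{[n]} φ then Γ ⊢_{[-1]} □ⁿ(⋀Σ → φ), where ⋀∅ = ⊤. -/

import Mathlib

universe u v

namespace BQL

structure Signature : Type 1 where
  Const : Type
  Func : Type
  arityF : Func → ℕ
  Rel : Type
  arityR : Rel → ℕ

inductive Term (L : Signature) : Type
  | var : ℕ → Term L
  | const : L.Const → Term L
  | func : (f : L.Func) → (Fin (L.arityF f) → Term L) → Term L

inductive Formula (L : Signature) : Type
  | top : Formula L
  | bot : Formula L
  | rel : (R : L.Rel) → (Fin (L.arityR R) → Term L) → Formula L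
  | and : Formula L → Formula L → Formula L
  | or : Formula L → Formula L → Formula L
  | imp : Formula L → Formula L → Formula L
  | all : Formula L → Formula L
  | ex : Formula L → Formula L

variable {L : Signature}

namespace Term

/-- Shift all (free) variables of a term up by one. -/
def shiftUp : Term L → Term L
  | var n => var (n + 1)
  | const c => const c
  | func f ts => func f fun i => (ts i).shiftUp

/-- Apply a simultaneous substitution to a term. -/
def applySub (σ : ℕ → Term L) : Term L → Term L
  | var n => σ n
  | const c => const c
  | func f ts => func f fun i => (ts i).applySub σ

/-- All variables of the term are `< k`. -/
def ClosedAt : Term L → ℕ → Prop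
  | var n, k => n < k
  | const _, _ => True
  | func _ ts, k => ∀ i, (ts i).ClosedAt k

/-- A closed term. -/
def Closed (t : Term L) : Prop := t.ClosedAt 0

/-- The constant `c` occurs in the term. -/
def OccC (c : L.Const) : Term L → Prop
  | var _ => False
  | const d => d = c
  | func _ ts => ∃ i, (ts i).OccC c

end Term

/-- Lift a substitution under a binder. -/
def liftSub (σ : ℕ → Term L) : ℕ → Term L
  | 0 => .var 0
  | n + 1 => (σ n).shiftUp

namespace Formula

/-- Apply a simultaneous substitution to a formula. -/
def applySub (σ : ℕ → Term L) : Formula L → Formula L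
  | top => top
  | bot => bot
  | rel R ts => rel R fun i => (ts i).applySub σ
  | and φ ψ => and (φ.applySub σ) (ψ.applySub σ)
  | or φ ψ => or (φ.applySub σ) (ψ.applySub σ)
  | imp φ ψ => imp (φ.applySub σ) (ψ.applySub σ)
  | all φ => all (φ.applySub (liftSub σ))
  | ex φ => ex (φ.applySub (liftSub σ))

/-- All free variables of the formula are `< k`. -/
def ClosedAt : Formula L → ℕ → Prop
  | top, _ => True
  | bot, _ => True
  | rel _ ts, k => ∀ i, (ts i).ClosedAt k
  | and φ ψ, k => φ.ClosedAt k ∧ ψ.ClosedAt k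
  | or φ ψ, k => φ.ClosedAt k ∧ ψ.ClosedAt k
  | imp φ ψ, k => φ.ClosedAt k ∧ ψ.ClosedAt k
  | all φ, k => φ.ClosedAt (k + 1)
  | ex φ, k => φ.ClosedAt (k + 1)

/-- A sentence: a formula with no free variables. -/
def Sentence (φ : Formula L) : Prop := φ.ClosedAt 0

/-- The constant `c` occurs in the formula. -/
def OccC (c : L.Const) : Formula L → Prop
  | top => False
  | bot => False
  | rel _ ts => ∃ i, (ts i).OccC c
  | and φ ψ => φ.OccC c ∨ ψ.OccC c
  | or φ ψ => φ.OccC c ∨ ψ.OccC c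
  | imp φ ψ => φ.OccC c ∨ ψ.OccC c
  | all φ => φ.OccC c
  | ex φ => φ.OccC c

/-- The formula contains no occurrence of `∨` and no occurrence of `∃`. -/
def NoOrEx : Formula L → Prop
  | top => True
  | bot => True
  | rel _ _ => True
  | and φ ψ => φ.NoOrEx ∧ ψ.NoOrEx
  | or _ _ => False
  | imp φ ψ => φ.NoOrEx ∧ ψ.NoOrEx
  | all φ => φ.NoOrEx
  | ex _ => False

end Formula

/-- Substitute the term `t` for the variable `v₀` (lowering the other variables). -/
def subst0 (φ : Formula L) (t : Term L) : Formula L :=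
  φ.applySub fun n => match n with | 0 => t | n + 1 => .var n

/-- `□ⁿφ`, where `□φ` abbreviates `⊤ → φ`. -/
def boxN : ℕ → Formula L → Formula L
  | 0, φ => φ
  | n + 1, φ => .imp .top (boxN n φ)

/-- The conjunction of a finite list of formulas (`⋀∅ = ⊤`). -/
def conjL : List (Formula L) → Formula L
  | [] => .top
  | [φ] => φ
  | φ :: ψ :: l => .and φ (conjL (ψ :: l))

/-- The language `L⁺`, obtained from `L` by adding countably many fresh constants `aᵢ`. -/
def Signature.plus (L : Signature) : Signature where
  Const := L.Const ⊕ ℕ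
  Func := L.Func
  arityF := L.arityF
  Rel := L.Rel
  arityR := L.arityR

/-- The fresh constant `aᵢ` of `L⁺`. -/
def aconst (L : Signature) (i : ℕ) : Term L.plus := .const (Sum.inr i)

/-- Embedding of `L`-terms into `L⁺`-terms. -/
def Term.emb : Term L → Term L.plus
  | .var n => .var n
  | .const c => .const (Sum.inl c)
  | .func f ts => .func f fun i => (ts i).emb

/-- Embedding of `L`-formulas into `L⁺`-formulas. -/
def Formula.emb : Formula L → Formula L.plus
  | .top => .top
  | .bot => .bot
  | .rel R ts => .rel R fun i => (ts i).emb
  | .and φ ψ => .and φ.emb ψ.emb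
  | .or φ ψ => .or φ.emb ψ.emb
  | .imp φ ψ => .imp φ.emb ψ.emb
  | .all φ => .all φ.emb
  | .ex φ => .ex φ.emb

/-- The fresh constant `aᵢ` occurs in no member of `Γ`. -/
def FreshIn (i : ℕ) (Γ : Set (Formula L.plus)) : Prop :=
  ∀ ψ ∈ Γ, ¬ ψ.OccC (Sum.inr i)

/-- A Kripke `L`-model (the frame conditions are packaged in `KModel.Proper`). -/
structure KModel (L : Signature) : Type (u + 1) where
  W : Type u
  acc : W → W → Prop
  D : Type u
  interpC : L.Const → D
  interpF : (f : L.Func) → (Fin (L.arityF f) → D) → D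
  interpR : (R : L.Rel) → W → Set (Fin (L.arityR R) → D)

/-- The conditions on an `L`-model: nonempty set of worlds, transitive accessibility
relation, nonempty domain, and the persistence constraint. -/
def KModel.Proper (M : KModel.{u} L) : Prop :=
  Nonempty M.W ∧ Nonempty M.D ∧ Transitive M.acc ∧
    ∀ (R : L.Rel) (w u' : M.W), M.acc w u' → M.interpR R w ⊆ M.interpR R u'

/-- Prepend a value to a valuation. -/
def vcons {α : Sort*} (d : α) (ρ : ℕ → α) : ℕ → α
  | 0 => d
  | n + 1 => ρ n

/-- Denotation of a term. -/
def Term.eval (M : KModel.{u} L) (ρ : ℕ → M.D) : Term L → M.D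
  | .var n => ρ n
  | .const c => M.interpC c
  | .func f ts => M.interpF f fun i => (ts i).eval M ρ

/-- The satisfaction relation `w ⊩ φ(ā)`. -/
def Sat (M : KModel.{u} L) : M.W → (ℕ → M.D) → Formula L → Prop
  | _, _, .top => True
  | _, _, .bot => False
  | w, ρ, .rel R ts => (fun i => (ts i).eval M ρ) ∈ M.interpR R w
  | w, ρ, .and φ ψ => Sat M w ρ φ ∧ Sat M w ρ ψ
  | w, ρ, .or φ ψ => Sat M w ρ φ ∨ Sat M w ρ ψ
  | w, ρ, .imp φ ψ => ∀ u', M.acc w u' → Sat M u' ρ φ → Sat M u' ρ ψ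
  | w, ρ, .all φ => ∀ d, Sat M w (vcons d ρ) φ
  | w, ρ, .ex φ => ∃ d, Sat M w (vcons d ρ) φ

/-- Satisfaction of a sentence (under every valuation). -/
def SatS (M : KModel.{u} L) (w : M.W) (φ : Formula L) : Prop := ∀ ρ, Sat M w ρ φ

/-- `Γ ⊨ φ`: truth is preserved at every reflexive world of every `L`-model. -/
def Models (Γ : Set (Formula L)) (φ : Formula L) : Prop :=
  ∀ M : KModel.{u} L, M.Proper → ∀ w : M.W, M.acc w w →
    (∀ ψ ∈ Γ, SatS M w ψ) → SatS M w φ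

/-- `Γ : Δ ⊨ φ`: for every `L`-model, every reflexive world `w` and every world `u ≻ w`:
if `w ⊩ Γ` and `u ⊩ Δ` then `u ⊩ φ`. -/
def ModelsCtx (Γ Δ : Set (Formula L)) (φ : Formula L) : Prop :=
  ∀ M : KModel.{u} L, M.Proper → ∀ w u' : M.W, M.acc w w → M.acc w u' →
    (∀ ψ ∈ Γ, SatS M w ψ) → (∀ ψ ∈ Δ, SatS M u' ψ) → SatS M u' φ

end BQL

namespace BQL

/-- `PrfN L n Γ Δ φ` formalizes `Γ : Δ ⊢_{[n-1]} φ`: there is a proof of `φ` in the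
system `NBQL_CD[n-1]` (so `PrfN L 0` is the system `NBQL_CD`, i.e. `⊢_{[-1]}`, which
has no modus ponens at all) whose open assumptions all belong to `Γ ∪ Δ` and in which
every open assumption occurring unsafely (i.e. in the right main subproof of an
application of the restricted modus ponens rule) belongs to `Γ`.  The restricted
modus ponens rule of `NBQL_CD[n-1]` requires its right main subproof to lie entirely
within `NBQL_CD[m-1]` for some `m < n`. -/
inductive PrfN (L : Signature) :
    ℕ → Set (Formula L.plus) → Set (Formula L.plus) → Formula L.plus → Prop
  | hyp {n Γ Δ φ} : φ ∈ Γ ∪ Δ → φ.Sentence → PrfN L n Γ Δ φ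
  | weaken {n Γ Γ' Δ Δ' φ} : Γ ⊆ Γ' → Δ ⊆ Δ' → PrfN L n Γ Δ φ → PrfN L n Γ' Δ' φ
  | topIntro {n Γ Δ} : PrfN L n Γ Δ .top
  | botElim {n Γ Δ φ} : φ.Sentence → PrfN L n Γ Δ .bot → PrfN L n Γ Δ φ
  | andIntro {n Γ Δ φ ψ} : PrfN L n Γ Δ φ → PrfN L n Γ Δ ψ → PrfN L n Γ Δ (.and φ ψ)
  | andElimL {n Γ Δ φ ψ} : PrfN L n Γ Δ (.and φ ψ) → PrfN L n Γ Δ φ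
  | andElimR {n Γ Δ φ ψ} : PrfN L n Γ Δ (.and φ ψ) → PrfN L n Γ Δ ψ
  | orIntroL {n Γ Δ φ ψ} : ψ.Sentence → PrfN L n Γ Δ φ → PrfN L n Γ Δ (.or φ ψ)
  | orIntroR {n Γ Δ φ ψ} : φ.Sentence → PrfN L n Γ Δ ψ → PrfN L n Γ Δ (.or φ ψ)
  | orElim {n Γ Δ φ ψ χ} : PrfN L n Γ Δ (.or φ ψ) → PrfN L n Γ (insert φ Δ) χ →
      PrfN L n Γ (insert ψ Δ) χ → PrfN L n Γ Δ χ
  | impIntro {n Γ Δ φ ψ} : φ.Sentence → PrfN L n Γ (insert φ Δ) ψ →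
      PrfN L n Γ Δ (.imp φ ψ)
  | impElim {n m Γ Δ φ ψ} : m < n → PrfN L n Γ Δ φ → PrfN L m Γ ∅ (.imp φ ψ) →
      PrfN L n Γ Δ ψ
  | intTrans {n Γ Δ φ ψ χ} : PrfN L n Γ Δ (.imp φ ψ) → PrfN L n Γ Δ (.imp ψ χ) →
      PrfN L n Γ Δ (.imp φ χ)
  | intAndIntro {n Γ Δ φ ψ χ} : PrfN L n Γ Δ (.imp φ ψ) → PrfN L n Γ Δ (.imp φ χ) →
      PrfN L n Γ Δ (.imp φ (.and ψ χ))
  | intOrElim {n Γ Δ φ ψ χ} : PrfN L n Γ Δ (.imp φ χ) → PrfN L n Γ Δ (.imp ψ χ) →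
      PrfN L n Γ Δ (.imp (.or φ ψ) χ)
  | intAllIntro {n Γ Δ φ ψ} : φ.Sentence → PrfN L n Γ Δ (.all (.imp φ ψ)) →
      PrfN L n Γ Δ (.imp φ (.all ψ))
  | intExElim {n Γ Δ φ ψ} : ψ.Sentence → PrfN L n Γ Δ (.all (.imp φ ψ)) →
      PrfN L n Γ Δ (.imp (.ex φ) ψ)
  | allIntro {n Γ Δ Γ' Δ' φ} {i : ℕ} : Γ' ⊆ Γ → Δ' ⊆ Δ → FreshIn i Γ' → FreshIn i Δ' →
      ¬ φ.OccC (Sum.inr i) → PrfN L n Γ' Δ' (subst0 φ (aconst L i)) →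
      PrfN L n Γ Δ (.all φ)
  | allElim {n Γ Δ φ} {t : Term L.plus} : t.Closed → PrfN L n Γ Δ (.all φ) →
      PrfN L n Γ Δ (subst0 φ t)
  | cd {n Γ Δ φ ψ} : φ.Sentence → PrfN L n Γ Δ (.all (.or φ ψ)) →
      PrfN L n Γ Δ (.or φ (.all ψ))
  | exIntro {n Γ Δ φ} {t : Term L.plus} : t.Closed → (Formula.ex φ).Sentence →
      PrfN L n Γ Δ (subst0 φ t) → PrfN L n Γ Δ (.ex φ)
  | exElim {n Γ Δ Γ' Δ' φ ψ} {i : ℕ} : Γ' ⊆ Γ → Δ' ⊆ Δ → FreshIn i Γ' → FreshIn i Δ' →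
      ¬ φ.OccC (Sum.inr i) → ¬ ψ.OccC (Sum.inr i) → PrfN L n Γ Δ (.ex φ) →
      PrfN L n Γ' (insert (subst0 φ (aconst L i)) Δ') ψ → PrfN L n Γ Δ ψ

/-- `Γ ⊢_{[-1]} φ`: there is a proof of `φ` from `Γ` in `NBQL_CD`
(the system `NBQL_CD^r` with `→`-Elim deleted). -/
def PrvB (L : Signature) (Γ : Set (Formula L.plus)) (φ : Formula L.plus) : Prop :=
  PrfN L 0 Γ ∅ φ

end BQL

namespace BQL

section Substitution

variable {L : Signature}

theorem Term.closedAt_shiftUp (t : Term L) (k : ℕ) :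
    t.shiftUp.ClosedAt (k + 1) ↔ t.ClosedAt k := by
  induction t with
  | var n => simp [shiftUp, ClosedAt]
  | const c => simp [shiftUp, ClosedAt]
  | func f ts ih => simp [shiftUp, ClosedAt, ih]

theorem Term.applySub_eq_self (t : Term L) {k : ℕ} {σ : ℕ → Term L} (ht : t.ClosedAt k)
    (hσ : ∀ n < k, σ n = .var n) : t.applySub σ = t := by
  induction t with
  | var n => exact hσ n ht
  | const c => rfl
  | func f ts ih => simp only [applySub, fun i => ih i (ht i)]

theorem Term.ClosedAt.applySub (t : Term L) {k j : ℕ} {σ : ℕ → Term L} (ht : t.ClosedAt k)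
    (hσ : ∀ n < k, (σ n).ClosedAt j) : (t.applySub σ).ClosedAt j := by
  induction t with
  | var n => exact hσ n ht
  | const c => trivial
  | func f ts ih => exact fun i => ih i (ht i)

theorem Term.ClosedAt.of_applySub (t : Term L) {k j : ℕ} {σ : ℕ → Term L}
    (ht : (t.applySub σ).ClosedAt j) (hσ : ∀ n, (σ n).ClosedAt j → n < k) : t.ClosedAt k := by
  induction t with
  | var n => exact hσ n ht
  | const c => trivial
  | func f ts ih => exact fun i => ih i (ht i)

theorem Formula.applySub_eq_self (φ : Formula L) {k : ℕ} {σ : ℕ → Term L} (hφ : φ.ClosedAt k)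
    (hσ : ∀ n < k, σ n = .var n) : φ.applySub σ = φ := by
  have lift : ∀ {k : ℕ} {σ : ℕ → Term L}, (∀ n < k, σ n = .var n) →
      ∀ n < k + 1, liftSub σ n = .var n := by
    rintro k σ h (_ | n) hn
    · rfl
    · simp [liftSub, h n (by omega), Term.shiftUp]
  induction φ generalizing k σ with
  | top => rfl
  | bot => rfl
  | rel R ts => simp only [applySub, fun i => (ts i).applySub_eq_self (hφ i) hσ]
  | and φ ψ ih₁ ih₂ => simp only [applySub, ih₁ hφ.1 hσ, ih₂ hφ.2 hσ]
  | or φ ψ ih₁ ih₂ => simp only [applySub, ih₁ hφ.1 hσ, ih₂ hφ.2 hσ]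
  | imp φ ψ ih₁ ih₂ => simp only [applySub, ih₁ hφ.1 hσ, ih₂ hφ.2 hσ]
  | all φ ih => rw [applySub, ih hφ (lift hσ)]
  | ex φ ih => rw [applySub, ih hφ (lift hσ)]

theorem Formula.ClosedAt.applySub (φ : Formula L) {k j : ℕ} {σ : ℕ → Term L}
    (hφ : φ.ClosedAt k) (hσ : ∀ n < k, (σ n).ClosedAt j) : (φ.applySub σ).ClosedAt j := by
  have lift : ∀ {k j : ℕ} {σ : ℕ → Term L}, (∀ n < k, (σ n).ClosedAt j) →
      ∀ n < k + 1, (liftSub σ n).ClosedAt (j + 1) := by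
    rintro k j σ h (_ | n) hn
    · exact Nat.succ_pos j
    · exact (Term.closedAt_shiftUp _ _).2 (h n (by omega))
  induction φ generalizing k j σ with
  | top => trivial
  | bot => trivial
  | rel R ts => exact fun i => Term.ClosedAt.applySub _ (hφ i) hσ
  | and φ ψ ih₁ ih₂ => exact ⟨ih₁ hφ.1 hσ, ih₂ hφ.2 hσ⟩
  | or φ ψ ih₁ ih₂ => exact ⟨ih₁ hφ.1 hσ, ih₂ hφ.2 hσ⟩
  | imp φ ψ ih₁ ih₂ => exact ⟨ih₁ hφ.1 hσ, ih₂ hφ.2 hσ⟩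
  | all φ ih => exact ih (k := k + 1) hφ (lift hσ)
  | ex φ ih => exact ih (k := k + 1) hφ (lift hσ)

theorem Formula.ClosedAt.of_applySub (φ : Formula L) {k j : ℕ} {σ : ℕ → Term L}
    (hφ : (φ.applySub σ).ClosedAt j) (hσ : ∀ n, (σ n).ClosedAt j → n < k) : φ.ClosedAt k := by
  have lift : ∀ {k j : ℕ} {σ : ℕ → Term L}, (∀ n, (σ n).ClosedAt j → n < k) →
      ∀ n, (liftSub σ n).ClosedAt (j + 1) → n < k + 1 := by
    rintro k j σ h (_ | n) hn
    · exact Nat.succ_pos k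
    · exact Nat.succ_lt_succ (h n ((Term.closedAt_shiftUp _ _).1 hn))
  induction φ generalizing k j σ with
  | top => trivial
  | bot => trivial
  | rel R ts => exact fun i => Term.ClosedAt.of_applySub _ (hφ i) hσ
  | and φ ψ ih₁ ih₂ => exact ⟨ih₁ hφ.1 hσ, ih₂ hφ.2 hσ⟩
  | or φ ψ ih₁ ih₂ => exact ⟨ih₁ hφ.1 hσ, ih₂ hφ.2 hσ⟩
  | imp φ ψ ih₁ ih₂ => exact ⟨ih₁ hφ.1 hσ, ih₂ hφ.2 hσ⟩
  | all φ ih => exact ih hφ (lift hσ)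
  | ex φ ih => exact ih hφ (lift hσ)

theorem subst0_eq_self {φ : Formula L} (hφ : φ.Sentence) (t : Term L) : subst0 φ t = φ :=
  φ.applySub_eq_self hφ fun _ h => absurd h (Nat.not_lt_zero _)

theorem sentence_subst0 {φ : Formula L} {t : Term L} (ht : t.Closed) (hφ : φ.ClosedAt 1) :
    (subst0 φ t).Sentence := by
  refine Formula.ClosedAt.applySub φ hφ ?_
  rintro (_ | n) hn
  · exact ht
  · omega

theorem closedAt_one_of_subst0 {φ : Formula L} {t : Term L} (h : (subst0 φ t).Sentence) :
    φ.ClosedAt 1 := by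
  refine Formula.ClosedAt.of_applySub φ h ?_
  rintro (_ | n) hn
  · exact Nat.one_pos
  · exact absurd hn (Nat.not_lt_zero _)

theorem Term.ClosedAt.mono {t : Term L} {k j : ℕ} (h : t.ClosedAt k) (hkj : k ≤ j) :
    t.ClosedAt j := by
  induction t with
  | var n => exact lt_of_lt_of_le h hkj
  | const c => trivial
  | func f ts ih => exact fun i => ih i (h i)

theorem Formula.ClosedAt.mono {φ : Formula L} {k j : ℕ} (h : φ.ClosedAt k) (hkj : k ≤ j) :
    φ.ClosedAt j := by
  induction φ generalizing k j with
  | top => trivial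
  | bot => trivial
  | rel R ts => exact fun i => (h i).mono hkj
  | and φ ψ ih₁ ih₂ => exact ⟨ih₁ h.1 hkj, ih₂ h.2 hkj⟩
  | or φ ψ ih₁ ih₂ => exact ⟨ih₁ h.1 hkj, ih₂ h.2 hkj⟩
  | imp φ ψ ih₁ ih₂ => exact ⟨ih₁ h.1 hkj, ih₂ h.2 hkj⟩
  | all φ ih => exact ih (k := k + 1) h (by omega)
  | ex φ ih => exact ih (k := k + 1) h (by omega)

end Substitution

section Box

variable {L : Signature}

theorem closedAt_boxN {φ : Formula L} {k : ℕ} (n : ℕ) :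
    (boxN n φ).ClosedAt k ↔ φ.ClosedAt k := by
  induction n with
  | zero => rfl
  | succ n ih => simp [boxN, Formula.ClosedAt, ih]

theorem occC_boxN {φ : Formula L} {c : L.Const} (n : ℕ) :
    (boxN n φ).OccC c ↔ φ.OccC c := by
  induction n with
  | zero => rfl
  | succ n ih => simp [boxN, Formula.OccC, ih]

theorem subst0_boxN (φ : Formula L) (t : Term L) (n : ℕ) :
    subst0 (boxN n φ) t = boxN n (subst0 φ t) := by
  induction n with
  | zero => rfl
  | succ n ih => exact congrArg (Formula.imp .top) ih

theorem boxN_imp_top (φ : Formula L) (n : ℕ) : boxN n (.imp .top φ) = boxN (n + 1) φ := by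
  induction n with
  | zero => rfl
  | succ n ih => exact congrArg (Formula.imp .top) ih

theorem sentence_conjL {l : List (Formula L)} (h : ∀ α ∈ l, α.Sentence) :
    (conjL l).Sentence := by
  match l with
  | [] => trivial
  | [φ] => exact h φ (by simp)
  | φ :: ψ :: l => exact ⟨h φ (by simp), sentence_conjL fun α hα => h α (by simp_all)⟩

theorem not_occC_conjL {l : List (Formula L)} {c : L.Const} (h : ∀ α ∈ l, ¬ α.OccC c) :
    ¬ (conjL l).OccC c := by
  match l with
  | [] => exact id
  | [φ] => exact h φ (by simp)
  | φ :: ψ :: l =>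
    exact not_or.2 ⟨h φ (by simp), not_occC_conjL fun α hα => h α (by simp_all)⟩

end Box

section Derivations

variable {L : Signature} {Γ Δ : Set (Formula L.plus)} {A B C S : Formula L.plus}

theorem PrfN.sentence {k : ℕ} (h : PrfN L k Γ Δ A) : A.Sentence := by
  induction h with
  | hyp _ h => exact h
  | weaken _ _ _ ih => exact ih
  | topIntro => trivial
  | botElim h _ _ => exact h
  | andIntro _ _ ih₁ ih₂ => exact ⟨ih₁, ih₂⟩
  | andElimL _ ih => exact ih.1
  | andElimR _ ih => exact ih.2
  | orIntroL h _ ih => exact ⟨ih, h⟩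
  | orIntroR h _ ih => exact ⟨h, ih⟩
  | orElim _ _ _ _ ih _ => exact ih
  | impIntro h _ ih => exact ⟨h, ih⟩
  | impElim _ _ _ _ ih => exact ih.2
  | intTrans _ _ ih₁ ih₂ => exact ⟨ih₁.1, ih₂.2⟩
  | intAndIntro _ _ ih₁ ih₂ => exact ⟨ih₁.1, ih₁.2, ih₂.2⟩
  | intOrElim _ _ ih₁ ih₂ => exact ⟨⟨ih₁.1, ih₂.1⟩, ih₁.2⟩
  | intAllIntro h _ ih => exact ⟨h, ih.2⟩
  | intExElim h _ ih => exact ⟨ih.1, h⟩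
  | allIntro _ _ _ _ _ _ ih => exact closedAt_one_of_subst0 ih
  | allElim ht _ ih => exact sentence_subst0 ht ih
  | cd h _ ih => exact ⟨h, ih.2⟩
  | exIntro _ h _ _ => exact h
  | exElim _ _ _ _ _ _ _ _ _ ih => exact ih

theorem PrfN.asm {k : ℕ} (h : A ∈ Δ) (hA : A.Sentence) : PrfN L k Γ Δ A :=
  .hyp (.inr h) hA

theorem PrfN.cut {k : ℕ} (h₁ : PrfN L k Γ Δ A) (h₂ : PrfN L k ∅ {A} B) : PrfN L k Γ Δ B :=
  have h : PrfN L k Γ (insert A Δ) B := .weaken (by simp) (by simp) h₂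
  .orElim (.orIntroL h₁.sentence h₁) h h

theorem PrfN.cut₂ {k : ℕ} (h₁ : PrfN L k Γ Δ A) (h₂ : PrfN L k Γ Δ B)
    (h₃ : PrfN L k ∅ {A, B} C) : PrfN L k Γ Δ C := by
  have hB : PrfN L k Γ (insert A Δ) B := h₂.weaken subset_rfl (by simp)
  have h : PrfN L k Γ (insert B (insert A Δ)) C := .weaken (by simp) (by intro; simp; tauto) h₃
  have h' : PrfN L k Γ (insert A Δ) C := .orElim (.orIntroL hB.sentence hB) h h
  exact .orElim (.orIntroL h₁.sentence h₁) h' h'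

/-- Discharging the only assumption of a derivation yields a theorem. -/
theorem PrfN.imp_of {k : ℕ} (hA : A.Sentence) (h : PrfN L k ∅ {A} B) :
    PrfN L k Γ Δ (.imp A B) :=
  .impIntro hA (.weaken (by simp) (by simp) h)

theorem PrfN.boxN_intro {k : ℕ} (h : PrfN L k Γ Δ A) (n : ℕ) : PrfN L k Γ Δ (boxN n A) := by
  induction n with
  | zero => exact h
  | succ n ih => exact .impIntro trivial (ih.weaken subset_rfl (by simp))

theorem PrfN.boxN_map {n : ℕ} (h : PrfN L 0 Γ Δ (boxN n A)) (hAB : PrfN L 0 ∅ {A} B) :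
    PrfN L 0 Γ Δ (boxN n B) := by
  have hA : A.Sentence := (closedAt_boxN n).1 h.sentence
  induction n generalizing Γ Δ with
  | zero => exact h.cut hAB
  | succ n ih =>
    have hn := (closedAt_boxN (k := 0) n).2 hA
    exact .intTrans h (.imp_of hn (ih (.asm rfl hn)))

theorem PrfN.boxN_and {n : ℕ} (h₁ : PrfN L 0 Γ Δ (boxN n A)) (h₂ : PrfN L 0 Γ Δ (boxN n B)) :
    PrfN L 0 Γ Δ (boxN n (.and A B)) := by
  have hA : A.Sentence := (closedAt_boxN n).1 h₁.sentence
  have hB : B.Sentence := (closedAt_boxN n).1 h₂.sentence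
  induction n generalizing Γ Δ with
  | zero => exact .andIntro h₁ h₂
  | succ n ih =>
    have hn : (Formula.and (boxN n A) (boxN n B)).Sentence :=
      ⟨(closedAt_boxN n).2 hA, (closedAt_boxN n).2 hB⟩
    exact .intTrans (.intAndIntro h₁ h₂)
      (.imp_of hn (ih (.andElimL (.asm rfl hn)) (.andElimR (.asm rfl hn))))

theorem PrfN.boxN_map₂ {n : ℕ} (h₁ : PrfN L 0 Γ Δ (boxN n A)) (h₂ : PrfN L 0 Γ Δ (boxN n B))
    (h : PrfN L 0 ∅ {A, B} C) : PrfN L 0 Γ Δ (boxN n C) := by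
  have hAB := boxN_and h₁ h₂
  have hs : (Formula.and A B).Sentence := (closedAt_boxN n).1 hAB.sentence
  exact hAB.boxN_map (.cut₂ (.andElimL (.asm rfl hs)) (.andElimR (.asm rfl hs)) h)

theorem PrfN.boxN_all {n : ℕ} (h : PrfN L 0 Γ Δ (.all (boxN n A))) :
    PrfN L 0 Γ Δ (boxN n (.all A)) := by
  have hA : A.ClosedAt 1 := (closedAt_boxN n).1 h.sentence
  induction n generalizing Γ Δ with
  | zero => exact h
  | succ n ih =>
    have hn : (Formula.all (boxN n A)).Sentence := (closedAt_boxN (k := 1) n).2 hA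
    exact .intTrans (.intAllIntro trivial h) (.imp_of hn (ih (.asm rfl hn)))

/-- A derivation of `B` from `A` lifts to the scope of `□ⁿ(S → ·)`. -/
theorem PrfN.boxN_imp_map {n : ℕ} (h : PrfN L 0 Γ Δ (boxN n (.imp S A)))
    (hAB : PrfN L 0 ∅ {A} B) : PrfN L 0 Γ Δ (boxN n (.imp S B)) := by
  have hs : (Formula.imp S A).Sentence := (closedAt_boxN n).1 h.sentence
  exact h.boxN_map (.intTrans (.asm rfl hs) (.imp_of hs.2 hAB))

theorem PrfN.boxN_imp_map₂ {n : ℕ} (h₁ : PrfN L 0 Γ Δ (boxN n (.imp S A)))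
    (h₂ : PrfN L 0 Γ Δ (boxN n (.imp S B))) (h : PrfN L 0 ∅ {A, B} C) :
    PrfN L 0 Γ Δ (boxN n (.imp S C)) := by
  have hA : (Formula.imp S A).Sentence := (closedAt_boxN n).1 h₁.sentence
  have hB : (Formula.imp S B).Sentence := (closedAt_boxN n).1 h₂.sentence
  have hAB : (Formula.and A B).Sentence := ⟨hA.2, hB.2⟩
  refine h₁.boxN_map₂ h₂ (.intTrans
    (.intAndIntro (.asm (by simp) hA) (.asm (by simp) hB)) (.imp_of hAB ?_))
  exact .cut₂ (.andElimL (.asm rfl hAB)) (.andElimR (.asm rfl hAB)) h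

/-- Internal cut: `□ⁿ(S → A)` and `□ⁿ(A ∧ S → B)` yield `□ⁿ(S → B)`. -/
theorem PrfN.boxN_imp_cut {n : ℕ} (h₁ : PrfN L 0 Γ Δ (boxN n (.imp S A)))
    (h₂ : PrfN L 0 Γ Δ (boxN n (.imp (.and A S) B))) : PrfN L 0 Γ Δ (boxN n (.imp S B)) := by
  have hA : (Formula.imp S A).Sentence := (closedAt_boxN n).1 h₁.sentence
  have hB : (Formula.imp (.and A S) B).Sentence := (closedAt_boxN n).1 h₂.sentence
  exact h₁.boxN_map₂ h₂ (.intTrans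
    (.intAndIntro (.asm (by simp) hA) (.imp_of hA.1 (.asm rfl hA.1))) (.asm (by simp) hB))

theorem PrfN.conjL_intro {k : ℕ} {l : List (Formula L.plus)}
    (h : ∀ α ∈ l, PrfN L k Γ Δ α) : PrfN L k Γ Δ (conjL l) := by
  match l with
  | [] => exact .topIntro
  | [φ] => exact h φ (by simp)
  | φ :: ψ :: l => exact .andIntro (h φ (by simp)) (conjL_intro fun α hα => h α (by simp_all))

theorem PrfN.conjL_elim {k : ℕ} {l : List (Formula L.plus)}
    (h : PrfN L k Γ Δ (conjL l)) (hA : A ∈ l) : PrfN L k Γ Δ A := by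
  match l with
  | [φ] => exact List.mem_singleton.1 hA ▸ h
  | φ :: ψ :: l =>
    rcases List.mem_cons.1 hA with rfl | hA
    · exact .andElimL h
    · exact conjL_elim (.andElimR h) hA

theorem PrfN.conjL_cons {k : ℕ} {l l' : List (Formula L.plus)} (hA : PrfN L k Γ Δ A)
    (h : PrfN L k Γ Δ (conjL l)) (hl : l' ⊆ l) : PrfN L k Γ Δ (conjL (A :: l')) :=
  conjL_intro fun α hα => by
    rcases List.mem_cons.1 hα with rfl | hα
    · exact hA
    · exact h.conjL_elim (hl hα)

/-- Universal generalization under `□ⁿ`. -/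
theorem PrfN.boxN_gen {n i : ℕ} (hΓ : FreshIn i Γ) (hΔ : FreshIn i Δ)
    (hA : ¬ A.OccC (Sum.inr i)) (h : PrfN L 0 Γ Δ (boxN n (subst0 A (aconst L i)))) :
    PrfN L 0 Γ Δ (boxN n (.all A)) := by
  refine boxN_all (.allIntro (i := i) subset_rfl subset_rfl hΓ hΔ (mt (occC_boxN n).1 hA) ?_)
  rwa [subst0_boxN]

/-- Existential quantification absorbs a conjoined sentence. -/
theorem PrfN.ex_and {i : ℕ} (hA : (Formula.ex A).Sentence) (hS : S.Sentence)
    (hAi : ¬ A.OccC (Sum.inr i)) (hSi : ¬ S.OccC (Sum.inr i))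
    (h₁ : PrfN L 0 Γ Δ (.ex A)) (h₂ : PrfN L 0 Γ Δ S) : PrfN L 0 Γ Δ (.ex (.and A S)) := by
  have hAa : (subst0 A (aconst L i)).Sentence := sentence_subst0 trivial hA
  refine h₁.cut₂ h₂ (.exElim (Γ' := ∅) (Δ' := {S}) (i := i) subset_rfl (by simp)
    (by simp [FreshIn]) (by simpa [FreshIn]) hAi (not_or.2 ⟨hAi, hSi⟩) (.asm (by simp) hA) ?_)
  refine .exIntro (t := aconst L i) trivial ⟨hA, hS.mono (Nat.zero_le _)⟩ ?_
  change PrfN L 0 _ _ (.and (subst0 A _) (subst0 S _))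
  rw [subst0_eq_self hS]
  exact .andIntro (.asm (by simp) hAa) (.asm (by simp) hS)

theorem PrfN.relative_deduction {N : ℕ} (h : PrfN L N Γ Δ A) (n : ℕ) (hN : N ≤ n + 1)
    (l : List (Formula L.plus)) (hΔ : ∀ α ∈ Δ, α ∈ l) (hl : ∀ α ∈ l, α.Sentence) :
    PrfN L 0 Γ ∅ (boxN n (.imp (conjL l) A)) := by
  classical
  induction h generalizing n l with
  | @hyp N Γ Δ φ h hφ =>
    refine .boxN_intro (.impIntro (sentence_conjL hl) ?_) n
    rcases h with h | h
    · exact .hyp (.inl h) hφ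
    · exact conjL_elim (.asm (by simp) (sentence_conjL hl)) (hΔ _ h)
  | weaken hΓ' hΔ' _ ih =>
    exact (ih n hN l (fun α hα => hΔ α (hΔ' hα)) hl).weaken hΓ' subset_rfl
  | topIntro => exact .boxN_intro (.impIntro (sentence_conjL hl) .topIntro) n
  | botElim hφ _ ih => exact (ih n hN l hΔ hl).boxN_imp_map (.botElim hφ (.asm rfl trivial))
  | andIntro h₁ h₂ ih₁ ih₂ =>
    exact (ih₁ n hN l hΔ hl).boxN_imp_map₂ (ih₂ n hN l hΔ hl)
      (.andIntro (.asm (by simp) h₁.sentence) (.asm (by simp) h₂.sentence))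
  | andElimL h ih => exact (ih n hN l hΔ hl).boxN_imp_map (.andElimL (.asm rfl h.sentence))
  | andElimR h ih => exact (ih n hN l hΔ hl).boxN_imp_map (.andElimR (.asm rfl h.sentence))
  | orIntroL hψ h ih =>
    exact (ih n hN l hΔ hl).boxN_imp_map (.orIntroL hψ (.asm rfl h.sentence))
  | orIntroR hφ h ih =>
    exact (ih n hN l hΔ hl).boxN_imp_map (.orIntroR hφ (.asm rfl h.sentence))
  | @orElim N Γ Δ φ ψ χ h h₁ h₂ ih ih₁ ih₂ =>
    have hφ : φ.Sentence := h.sentence.1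
    have hψ : ψ.Sentence := h.sentence.2
    have hlφ : ∀ α ∈ φ :: l, α.Sentence := by simpa [hφ] using hl
    have hlψ : ∀ α ∈ ψ :: l, α.Sentence := by simpa [hψ] using hl
    have hcφ := sentence_conjL hlφ
    have hcψ := sentence_conjL hlψ
    have hc := sentence_conjL hl
    have hand : (Formula.and (.or φ ψ) (conjL l)).Sentence := ⟨h.sentence, hc⟩
    refine (ih n hN l hΔ hl).boxN_imp_cut
      ((ih₁ n hN (φ :: l) (by simp; tauto) hlφ).boxN_map₂
        (ih₂ n hN (ψ :: l) (by simp; tauto) hlψ)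
        (.intTrans (.imp_of hand ?_)
          (.intOrElim (.asm (by simp) ⟨hcφ, h₁.sentence⟩) (.asm (by simp) ⟨hcψ, h₂.sentence⟩))))
    refine .orElim (.andElimL (.asm rfl hand)) (.orIntroL hcψ ?_) (.orIntroR hcφ ?_)
    · exact conjL_cons (.asm (by simp) hφ) (.andElimR (.asm (by simp) hand))
        (List.Subset.refl l)
    · exact conjL_cons (.asm (by simp) hψ) (.andElimR (.asm (by simp) hand))
        (List.Subset.refl l)
  | @impIntro N Γ Δ φ ψ hφ h ih =>
    have hlφ : ∀ α ∈ φ :: l, α.Sentence := by simpa [hφ] using hl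
    have hc := sentence_conjL hl
    refine (ih n hN (φ :: l) (by simp; tauto) hlφ).boxN_map (.impIntro hc
      (.intTrans (.impIntro hφ ?_) (.asm (by simp) ⟨sentence_conjL hlφ, h.sentence⟩)))
    exact conjL_cons (.asm (by simp) hφ) (.asm (by simp) hc) (List.Subset.refl l)
  | @impElim N m Γ Δ φ ψ hm h₁ h₂ ih₁ ih₂ =>
    have h : PrfN L 0 Γ ∅ (boxN n (.imp φ ψ)) := by
      cases n with
      | zero =>
        obtain rfl : m = 0 := by omega
        exact h₂
      | succ n =>
        rw [← boxN_imp_top]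
        exact ih₂ n (by omega) [] (by simp) (by simp)
    exact (ih₁ n hN l hΔ hl).boxN_map₂ h (.intTrans
      (.asm (by simp) ⟨sentence_conjL hl, h₁.sentence⟩) (.asm (by simp) h₂.sentence))
  | intTrans h₁ h₂ ih₁ ih₂ =>
    exact (ih₁ n hN l hΔ hl).boxN_imp_map₂ (ih₂ n hN l hΔ hl)
      (.intTrans (.asm (by simp) h₁.sentence) (.asm (by simp) h₂.sentence))
  | intAndIntro h₁ h₂ ih₁ ih₂ =>
    exact (ih₁ n hN l hΔ hl).boxN_imp_map₂ (ih₂ n hN l hΔ hl)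
      (.intAndIntro (.asm (by simp) h₁.sentence) (.asm (by simp) h₂.sentence))
  | intOrElim h₁ h₂ ih₁ ih₂ =>
    exact (ih₁ n hN l hΔ hl).boxN_imp_map₂ (ih₂ n hN l hΔ hl)
      (.intOrElim (.asm (by simp) h₁.sentence) (.asm (by simp) h₂.sentence))
  | intAllIntro hφ h ih =>
    exact (ih n hN l hΔ hl).boxN_imp_map (.intAllIntro hφ (.asm rfl h.sentence))
  | intExElim hψ h ih =>
    exact (ih n hN l hΔ hl).boxN_imp_map (.intExElim hψ (.asm rfl h.sentence))
  | @allIntro N Γ Δ Γ' Δ' φ i hΓ' hΔ' hiΓ hiΔ hiφ h ih =>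
    let l' := l.filter (· ∈ Δ')
    have hsub : l' ⊆ l := List.filter_subset_self l
    have hl' : ∀ α ∈ l', α.Sentence := fun α hα => hl α (hsub hα)
    have hc := sentence_conjL hl
    have hc' := sentence_conjL hl'
    have hic : ¬ (conjL l').OccC (Sum.inr i) :=
      not_occC_conjL fun α hα => hiΔ α (by simpa using (List.mem_filter.1 hα).2)
    have hφ : (Formula.all φ).Sentence := closedAt_one_of_subst0 h.sentence
    have key : PrfN L 0 Γ' ∅ (boxN n (.all (.imp (conjL l') φ))) := by
      refine boxN_gen (i := i) hiΓ (by simp [FreshIn]) (not_or.2 ⟨hic, hiφ⟩) ?_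
      change PrfN L 0 _ _ (boxN n (.imp (subst0 (conjL l') _) (subst0 φ _)))
      rw [subst0_eq_self hc']
      exact ih n hN l' (fun α hα => by simp [l', hα, hΔ α (hΔ' hα)]) hl'
    refine (key.weaken hΓ' subset_rfl).boxN_map (.intTrans (.imp_of hc ?_)
      (.intAllIntro hc' (.asm rfl ⟨hc'.mono (Nat.zero_le _), hφ⟩)))
    exact conjL_intro fun α hα => conjL_elim (.asm rfl hc) (hsub hα)
  | allElim ht h ih => exact (ih n hN l hΔ hl).boxN_imp_map (.allElim ht (.asm rfl h.sentence))
  | cd hφ h ih => exact (ih n hN l hΔ hl).boxN_imp_map (.cd hφ (.asm rfl h.sentence))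
  | exIntro ht hφ h ih =>
    exact (ih n hN l hΔ hl).boxN_imp_map (.exIntro ht hφ (.asm rfl h.sentence))
  | @exElim N Γ Δ Γ' Δ' φ ψ i hΓ' hΔ' hiΓ hiΔ hiφ hiψ h₁ h₂ ih₁ ih₂ =>
    let l' := l.filter (· ∈ Δ')
    have hsub : l' ⊆ l := List.filter_subset_self l
    have hl' : ∀ α ∈ l', α.Sentence := fun α hα => hl α (hsub hα)
    have hc := sentence_conjL hl
    have hc' := sentence_conjL hl'
    have hic : ¬ (conjL l').OccC (Sum.inr i) :=
      not_occC_conjL fun α hα => hiΔ α (by simpa using (List.mem_filter.1 hα).2)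
    have hφ : (Formula.ex φ).Sentence := h₁.sentence
    have hφa : (subst0 φ (aconst L i)).Sentence := sentence_subst0 trivial hφ
    have hψ : ψ.Sentence := h₂.sentence
    have hlφ : ∀ α ∈ subst0 φ (aconst L i) :: l', α.Sentence := by simpa [hφa] using hl'
    have hand : (Formula.and (subst0 φ (aconst L i)) (conjL l')).Sentence := ⟨hφa, hc'⟩
    have key : PrfN L 0 Γ' ∅ (boxN n (.all (.imp (.and φ (conjL l')) ψ))) := by
      refine boxN_gen (i := i) hiΓ (by simp [FreshIn])
        (not_or.2 ⟨not_or.2 ⟨hiφ, hic⟩, hiψ⟩) ?_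
      change PrfN L 0 _ _ (boxN n
        (.imp (.and (subst0 φ _) (subst0 (conjL l') _)) (subst0 ψ _)))
      rw [subst0_eq_self hc', subst0_eq_self hψ]
      refine (ih₂ n hN (subst0 φ (aconst L i) :: l') ?_ hlφ).boxN_map
        (.intTrans (.imp_of hand ?_) (.asm rfl ⟨sentence_conjL hlφ, hψ⟩))
      · rintro α (rfl | hα)
        · simp
        · simp [l', hα, hΔ α (hΔ' hα)]
      · exact conjL_cons (.andElimL (.asm rfl hand)) (.andElimR (.asm rfl hand))
          (List.Subset.refl l')
    have hand' : (Formula.and (.ex φ) (conjL l)).Sentence := ⟨hφ, hc⟩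
    refine (ih₁ n hN l hΔ hl).boxN_imp_cut ((key.weaken hΓ' subset_rfl).boxN_map
      (.intTrans (.imp_of hand' ?_) (.intExElim hψ
        (.asm rfl ⟨⟨hφ, hc'.mono (Nat.zero_le _)⟩, hψ.mono (Nat.zero_le _)⟩))))
    exact ex_and hφ hc' hiφ hic (.andElimL (.asm rfl hand'))
      (conjL_intro fun α hα => conjL_elim (.andElimR (.asm rfl hand')) (hsub hα))

end Derivations

end BQL

namespace BQL

/-- **Relative Deduction** (Lemma 6): for finite `Σ` (given as a list) and `n ≥ 0`:
if `Γ : Σ ⊢_{[n]} φ` then `Γ ⊢_{[-1]} □ⁿ(⋀Σ → φ)` (with `⋀∅ = ⊤`). -/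
theorem relative_deduction {L : Signature} (n : ℕ) (Γ : Set (Formula L.plus))
    (Ss : List (Formula L.plus)) (φ : Formula L.plus)
    (hΓ : ∀ α ∈ Γ, Formula.Sentence α) (hSs : ∀ α ∈ Ss, Formula.Sentence α)
    (hφ : φ.Sentence)
    (h : PrfN L (n + 1) Γ {α | α ∈ Ss} φ) :
    PrvB L Γ (boxN n (.imp (conjL Ss) φ)) := by
  exact h.relative_deduction n le_rfl Ss (fun _ hα => hα) hSs

end BQL
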